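/- Let A be a densely defined, closed linear operator in H such that A + t₀I is of positive-type and A + t₀I ∈ Sect(ω₀) for some t₀ ∈ ℝ, ω₀ ∈ [0,π). Then the B(H)-valued function t ↦ (A + tI)^{-1/2}, t > t₀, extends to an analytic B(H)-valued function z ↦ (A − zI)^{-1/2} on ℂ \ closure(−t₀ + S_{ω₀}), given by (A − zI)^{-1/2} = (1/π)∫₀^∞ t^{-1/2}(A + (t − z)I)^{-1} dt; the analogous statement holds for the adjoint A*. Moreover, for every z ∈ ℂ \ closure(−t₀ + S_{ω₀}), dom((A − zI)^{1/2}) = dom((A + t₀I)^{1/2}) and dom((A* − zI)^{1/2}) = dom((A* + t₀I)^{1/2}); in particular these square-root domains are independent of z. -/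

import Mathlib

open MeasureTheory Filter
open scoped InnerProductSpace

noncomputable section
open scoped Classical


variable {H : Type*} [NormedAddCommGroup H] [InnerProductSpace ℂ H] [CompleteSpace H]

/-- `T` is the (bounded, everywhere defined) inverse of `A - z·I`. -/
def IsResolvent (A : H →ₗ.[ℂ] H) (z : ℂ) (T : H →L[ℂ] H) : Prop :=
  (∀ x : H, ∃ hx : T x ∈ A.domain, A ⟨T x, hx⟩ - z • T x = x) ∧
  ∀ u : A.domain, T (A u - z • (u : H)) = (u : H)

/-- The resolvent set of an unbounded operator. -/
def resolventSetP (A : H →ₗ.[ℂ] H) : Set ℂ := {z | ∃ T, IsResolvent A z T}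

/-- The spectrum of an unbounded operator. -/
def specP (A : H →ₗ.[ℂ] H) : Set ℂ := (resolventSetP A)ᶜ

/-- The resolvent `(A - z·I)⁻¹` (junk value `0` off the resolvent set). -/
def res (A : H →ₗ.[ℂ] H) (z : ℂ) : H →L[ℂ] H :=
  if h : ∃ T, IsResolvent A z T then h.choose else 0

/-- The operator `A + t·I` (same domain). -/
def shiftP (A : H →ₗ.[ℂ] H) (t : ℂ) : H →ₗ.[ℂ] H :=
  ⟨A.domain, A.toFun + t • A.domain.subtype⟩

/-- `A` is of positive type: `(-∞,0] ⊆ ρ(A)` and `sup_{t ≥ 0} ‖(1+t)(A+t)⁻¹‖ < ∞`. -/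
def IsPositiveTypeP (A : H →ₗ.[ℂ] H) : Prop :=
  (∀ x : ℝ, x ≤ 0 → (x : ℂ) ∈ resolventSetP A) ∧
  ∃ M : ℝ, ∀ t : ℝ, 0 ≤ t → (1 + t) * ‖res A (-(t : ℂ))‖ ≤ M

/-- The open sector of half-opening angle `ω` about the positive reals
(`(0,∞)` for `ω = 0`). -/
def sectorS (ω : ℝ) : Set ℂ :=
  if ω = 0 then (fun x : ℝ => (x : ℂ)) '' Set.Ioi 0
  else {z : ℂ | z ≠ 0 ∧ |Complex.arg z| < ω}

/-- `A` is sectorial of angle `ω`. -/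
def IsSectorialP (A : H →ₗ.[ℂ] H) (ω : ℝ) : Prop :=
  specP A ⊆ closure (sectorS ω) ∧
  ∀ ω' : ℝ, ω < ω' → ω' < Real.pi →
    ∃ M : ℝ, ∀ z ∈ (closure (sectorS ω'))ᶜ, ‖z‖ * ‖res A z‖ ≤ M

/-- The shifted sector `-t₀ + S_ω`. -/
def shiftedSector (t0 ω : ℝ) : Set ℂ := (fun w => -(t0 : ℂ) + w) '' sectorS ω

/-- The region `ℂ \ closure (-t₀ + S_ω)`. -/
def offSector (t0 ω : ℝ) : Set ℂ := (closure (shiftedSector t0 ω))ᶜ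

/-- The bounded operator `(A - z·I)^{-1/2}`, defined by the Balakrishnan-type formula
`(1/π) ∫₀^∞ t^{-1/2} (A + (t - z)·I)⁻¹ dt`. -/
def negSqrt (A : H →ₗ.[ℂ] H) (z : ℂ) : H →L[ℂ] H :=
  ((Real.pi : ℂ))⁻¹ • ∫ t in Set.Ioi (0 : ℝ), ((Real.sqrt t : ℂ))⁻¹ • res A (z - t)

/-- Trace-class (nuclear) bounded operators, characterized by
`sup { ∑ |⟨eᵢ, T fᵢ⟩| : (eᵢ), (fᵢ) finite orthonormal families } < ∞`. -/
def IsTraceClass (T : H →L[ℂ] H) : Prop :=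
  ∃ C : ℝ, ∀ (n : ℕ) (e f : Fin n → H), Orthonormal ℂ e → Orthonormal ℂ f →
    ∑ i, ‖⟪e i, T (f i)⟫_ℂ‖ ≤ C

/-- The trace norm `‖T‖₁`. -/
def traceNorm (T : H →L[ℂ] H) : ℝ :=
  sSup {s : ℝ | ∃ (n : ℕ) (e f : Fin n → H), Orthonormal ℂ e ∧ Orthonormal ℂ f ∧
    s = ∑ i, ‖⟪e i, T (f i)⟫_ℂ‖}

/-- The trace of a (trace-class) operator, computed in the Hilbert basis `b`. -/
def traceH (b : HilbertBasis ℕ ℂ H) (T : H →L[ℂ] H) : ℂ :=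
  ∑' n, ⟪(b n : H), T (b n)⟫_ℂ

/-- The Fredholm determinant `det (I + T)` (for `T` trace class), computed as the limit of
finite-section determinants along the Hilbert basis `b`. -/
def detI (b : HilbertBasis ℕ ℂ H) (T : H →L[ℂ] H) : ℂ :=
  limUnder atTop fun F : Finset ℕ =>
    Matrix.det (Matrix.of fun i j : F =>
      (if (i : ℕ) = (j : ℕ) then (1 : ℂ) else 0) + ⟪(b (i : ℕ) : H), T (b (j : ℕ))⟫_ℂ)


set_option linter.unusedSectionVars false

theorem IsResolvent.unique {A : H →ₗ.[ℂ] H} {z : ℂ} {S T : H →L[ℂ] H}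
    (hS : IsResolvent A z S) (hT : IsResolvent A z T) : S = T := by
  ext x
  obtain ⟨hx, h⟩ := hT.1 x
  have := hS.2 ⟨T x, hx⟩
  simpa only [h] using this

theorem isResolvent_res {A : H →ₗ.[ℂ] H} {z : ℂ} (hz : z ∈ resolventSetP A) :
    IsResolvent A z (res A z) := by
  have h : ∃ T, IsResolvent A z T := hz
  rw [res, dif_pos h]
  exact h.choose_spec

theorem IsResolvent.res_eq {A : H →ₗ.[ℂ] H} {z : ℂ} {T : H →L[ℂ] H}
    (hT : IsResolvent A z T) : res A z = T :=
  (isResolvent_res ⟨T, hT⟩).unique hT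

theorem res_of_notMem {A : H →ₗ.[ℂ] H} {z : ℂ} (hz : z ∉ resolventSetP A) : res A z = 0 :=
  dif_neg hz

theorem isResolvent_shiftP_iff {A : H →ₗ.[ℂ] H} {s z : ℂ} {T : H →L[ℂ] H} :
    IsResolvent (shiftP A s) z T ↔ IsResolvent A (z - s) T := by
  have key : ∀ u : A.domain, shiftP A s u - z • (u : H) = A u - (z - s) • (u : H) := by
    intro u
    change A u + s • (u : H) - z • (u : H) = _
    rw [sub_smul]; abel
  constructor
  · rintro ⟨h1, h2⟩
    refine ⟨fun x => ?_, fun u => ?_⟩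
    · obtain ⟨hx, h⟩ := h1 x
      exact ⟨hx, (key ⟨T x, hx⟩).symm.trans h⟩
    · rw [← key]; exact h2 u
  · rintro ⟨h1, h2⟩
    refine ⟨fun x => ?_, fun u => ?_⟩
    · obtain ⟨hx, h⟩ := h1 x
      exact ⟨hx, (key ⟨T x, hx⟩).trans h⟩
    · exact (congrArg T (key u)).trans (h2 u)

theorem mem_resolventSetP_shiftP_iff {A : H →ₗ.[ℂ] H} {s z : ℂ} :
    z ∈ resolventSetP (shiftP A s) ↔ z - s ∈ resolventSetP A :=
  exists_congr fun _ => isResolvent_shiftP_iff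

theorem res_shiftP {A : H →ₗ.[ℂ] H} {s z : ℂ} : res (shiftP A s) z = res A (z - s) := by
  by_cases h : z - s ∈ resolventSetP A
  · exact (isResolvent_shiftP_iff.2 (isResolvent_res h)).res_eq
  · rw [res_of_notMem h, res_of_notMem fun hz => h (mem_resolventSetP_shiftP_iff.1 hz)]

theorem IsResolvent.adjoint {A : H →ₗ.[ℂ] H} (hA : Dense (A.domain : Set H)) {z : ℂ}
    {T : H →L[ℂ] H} (hT : IsResolvent A z T) :
    IsResolvent A.adjoint (starRingEnd ℂ z) (ContinuousLinearMap.adjoint T) := by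
  have key : ∀ (x : H) (u : A.domain),
      ⟪x + starRingEnd ℂ z • ContinuousLinearMap.adjoint T x, (u : H)⟫_ℂ
        = ⟪ContinuousLinearMap.adjoint T x, A u⟫_ℂ := by
    intro x u
    have h : T (A u) = (u : H) + z • T u := by
      rw [← map_smul, ← sub_eq_iff_eq_add, ← map_sub]; exact hT.2 u
    rw [inner_add_left, inner_smul_left, ContinuousLinearMap.adjoint_inner_left,
      ContinuousLinearMap.adjoint_inner_left, h, inner_add_right, inner_smul_right]
    simp
  refine ⟨fun x => ?_, fun u => ?_⟩
  · refine ⟨LinearPMap.mem_adjoint_domain_of_exists _ ⟨_, key x⟩, ?_⟩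
    rw [LinearPMap.adjoint_apply_eq hA _ (key x)]
    abel
  · refine ext_inner_right ℂ fun x => ?_
    obtain ⟨hx, h⟩ := hT.1 x
    have h3 := LinearPMap.adjoint_isFormalAdjoint hA u ⟨T x, hx⟩
    rw [ContinuousLinearMap.adjoint_inner_left, inner_sub_left, inner_smul_left, h3]
    conv_rhs => rw [← h, inner_sub_right, inner_smul_right]
    simp

theorem IsResolvent.sub_eq {A : H →ₗ.[ℂ] H} {a b : ℂ} {S T : H →L[ℂ] H}
    (hS : IsResolvent A a S) (hT : IsResolvent A b T) : S - T = (a - b) • (S * T) := by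
  ext x
  obtain ⟨hx, h⟩ := hT.1 x
  have h2 : S (A ⟨T x, hx⟩ - a • T x) = T x := hS.2 ⟨T x, hx⟩
  have h3 : A ⟨T x, hx⟩ - a • T x = x - (a - b) • T x := by
    rw [eq_add_of_sub_eq h, sub_smul]; abel
  rw [h3, map_sub, map_smul] at h2
  change S x - T x = (a - b) • S (T x)
  rw [sub_eq_iff_eq_add, ← sub_eq_iff_eq_add', h2]

theorem IsResolvent.injective {A : H →ₗ.[ℂ] H} {a : ℂ} {S : H →L[ℂ] H}
    (hS : IsResolvent A a S) : Function.Injective S := by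
  refine (injective_iff_map_eq_zero S).2 fun x hx => ?_
  obtain ⟨h, h'⟩ := hS.1 x
  have : (⟨S x, h⟩ : A.domain) = 0 := Subtype.ext hx
  rw [← h', this, hx]; simp

theorem IsResolvent.commute {A : H →ₗ.[ℂ] H} {a b : ℂ} {S T : H →L[ℂ] H}
    (hS : IsResolvent A a S) (hT : IsResolvent A b T) : Commute S T := by
  rcases eq_or_ne a b with rfl | hab
  · rw [hS.unique hT]
  · have h1 := hS.sub_eq hT
    have h2 := hT.sub_eq hS
    have h3 : (a - b) • (S * T) = (a - b) • (T * S) := by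
      rw [← h1, ← neg_sub T S, h2, ← neg_smul, neg_sub]
    exact smul_right_injective _ (sub_ne_zero.2 hab) h3

theorem IsResolvent.exists_of_norm_lt {A : H →ₗ.[ℂ] H} {a b : ℂ} {S : H →L[ℂ] H}
    (hS : IsResolvent A a S) (h : ‖(b - a) • S‖ < 1) : ∃ T, IsResolvent A b T := by
  set U := Units.oneSub _ h
  have hU : (U : H →L[ℂ] H) = 1 - (b - a) • S := rfl
  have hc : Commute S (U : H →L[ℂ] H) := by
    rw [hU]
    exact (Commute.one_right _).sub_right ((Commute.refl S).smul_right _)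
  have hc' : S * (↑U⁻¹ : H →L[ℂ] H) = (↑U⁻¹ : H →L[ℂ] H) * S := hc.units_inv_right.eq
  have hUU : ∀ x, U.1 ((↑U⁻¹ : H →L[ℂ] H) x) = x := fun x => by
    change ((U : H →L[ℂ] H) * (↑U⁻¹ : H →L[ℂ] H)) x = x
    simp
  have hUU' : ∀ x, (↑U⁻¹ : H →L[ℂ] H) (U.1 x) = x := fun x => by
    change ((↑U⁻¹ : H →L[ℂ] H) * (U : H →L[ℂ] H)) x = x
    simp
  refine ⟨S * (↑U⁻¹ : H →L[ℂ] H), fun x => ?_, fun u => ?_⟩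
  · obtain ⟨hx, h⟩ := hS.1 ((↑U⁻¹ : H →L[ℂ] H) x)
    refine ⟨hx, ?_⟩
    have h4 := hUU x
    rw [hU] at h4
    change A ⟨S ((↑U⁻¹ : H →L[ℂ] H) x), hx⟩ - b • S ((↑U⁻¹ : H →L[ℂ] H) x) = x
    have h4' : (↑U⁻¹ : H →L[ℂ] H) x - (b - a) • S ((↑U⁻¹ : H →L[ℂ] H) x) = x := h4
    rw [eq_add_of_sub_eq h]
    conv_rhs => rw [← h4', sub_smul]
    abel
  · rw [hc']
    have h5 : S (A u - b • (u : H)) = U.1 u := by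
      have h6 : A u - b • (u : H) = (A u - a • (u : H)) - (b - a) • (u : H) := by
        rw [sub_smul]; abel
      rw [h6, map_sub, hS.2, map_smul]
      rfl
    change (↑U⁻¹ : H →L[ℂ] H) (S (A u - b • (u : H))) = u
    rw [h5, hUU']

theorem IsResolvent.norm_le_two_mul {A : H →ₗ.[ℂ] H} {a b : ℂ} {S T : H →L[ℂ] H}
    (hS : IsResolvent A a S) (hT : IsResolvent A b T) (h : ‖b - a‖ * ‖S‖ ≤ 1 / 2) :
    ‖T‖ ≤ 2 * ‖S‖ := by
  have h1 : T = S + (b - a) • (T * S) := by rw [← hT.sub_eq hS]; abel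
  have h2 : ‖(b - a) • (T * S)‖ ≤ ‖T‖ * (‖b - a‖ * ‖S‖) := by
    rw [norm_smul]
    calc ‖b - a‖ * ‖T * S‖ ≤ ‖b - a‖ * (‖T‖ * ‖S‖) := by gcongr; exact norm_mul_le _ _
      _ = _ := by ring
  have h3 : ‖T‖ ≤ ‖S‖ + ‖(b - a) • (T * S)‖ := by
    conv_lhs => rw [h1]
    exact norm_add_le _ _
  nlinarith [norm_nonneg T]

theorem mem_resolventSetP_of_norm_le {A : H →ₗ.[ℂ] H} {a b : ℂ} (ha : a ∈ resolventSetP A)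
    (h : ‖b - a‖ * ‖res A a‖ ≤ 1 / 2) : b ∈ resolventSetP A :=
  (isResolvent_res ha).exists_of_norm_lt (by rw [norm_smul]; linarith)

theorem hasDerivAt_res {A : H →ₗ.[ℂ] H} {a : ℂ} (ha : a ∈ resolventSetP A) :
    HasDerivAt (res A) (res A a * res A a) a := by
  have hR := isResolvent_res ha
  have hev : ∀ᶠ b in nhds a, ‖b - a‖ * ‖res A a‖ ≤ 1 / 2 := by
    have : ContinuousAt (fun b : ℂ => ‖b - a‖ * ‖res A a‖) a := by fun_prop
    exact this.eventually (Iic_mem_nhds (by simp))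
  have hsub : ∀ᶠ b in nhds a, res A b - res A a = (b - a) • (res A b * res A a) :=
    hev.mono fun b hb => (isResolvent_res (mem_resolventSetP_of_norm_le ha hb)).sub_eq hR
  have hcont : Tendsto (res A) (nhds a) (nhds (res A a)) := by
    rw [tendsto_iff_norm_sub_tendsto_zero]
    have h0 : Tendsto (fun b : ℂ => ‖b - a‖ * (2 * ‖res A a‖ * ‖res A a‖)) (nhds a) (nhds 0) := by
      have : ContinuousAt (fun b : ℂ => ‖b - a‖ * (2 * ‖res A a‖ * ‖res A a‖)) a := by fun_prop
      simpa [ContinuousAt] using this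
    refine squeeze_zero' (Eventually.of_forall fun _ => norm_nonneg _) ?_ h0
    filter_upwards [hev, hsub] with b hb hs
    rw [hs, norm_smul]
    gcongr
    refine (norm_mul_le _ _).trans ?_
    gcongr
    exact hR.norm_le_two_mul (isResolvent_res (mem_resolventSetP_of_norm_le ha hb)) hb
  rw [hasDerivAt_iff_tendsto_slope]
  have h1 : Tendsto (fun b => res A b * res A a) (nhdsWithin a {a}ᶜ)
      (nhds (res A a * res A a)) := (hcont.mul_const _).mono_left nhdsWithin_le_nhds
  refine h1.congr' ?_
  filter_upwards [hsub.filter_mono nhdsWithin_le_nhds, self_mem_nhdsWithin] with b hb hne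
  rw [slope_def_module, hb, smul_smul, inv_mul_cancel₀ (sub_ne_zero.2 hne), one_smul]

theorem ofReal_mem_closure_sectorS {ω t : ℝ} (hω : 0 ≤ ω) (ht : 0 ≤ t) :
    (t : ℂ) ∈ closure (sectorS ω) := by
  have h : Set.MapsTo (fun x : ℝ => (x : ℂ)) (Set.Ioi 0) (sectorS ω) := by
    intro x hx
    have hx' : (0 : ℝ) < x := hx
    rw [sectorS]
    split_ifs with h0
    · exact ⟨x, hx, rfl⟩
    · refine ⟨Complex.ofReal_ne_zero.2 hx'.ne', ?_⟩
      rw [Complex.arg_ofReal_of_nonneg hx'.le, abs_zero]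
      exact lt_of_le_of_ne hω (Ne.symm h0)
  refine map_mem_closure Complex.continuous_ofReal (s := Set.Ioi (0 : ℝ)) ?_ h
  rw [closure_Ioi]; exact ht

theorem mem_closure_sectorS_of_abs_arg_le {ω : ℝ} (hω' : ω < Real.pi) {w : ℂ}
    (hw : |Complex.arg w| ≤ ω) : w ∈ closure (sectorS ω) := by
  have hω : 0 ≤ ω := (abs_nonneg _).trans hw
  rcases eq_or_ne w 0 with rfl | hw0
  · simpa using ofReal_mem_closure_sectorS hω le_rfl
  rcases hω.eq_or_lt with rfl | hpos
  · have h0 : Complex.arg w = 0 := by simpa using hw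
    have : w = ((‖w‖ : ℝ) : ℂ) := by
      conv_lhs => rw [← Complex.norm_mul_exp_arg_mul_I w, h0]
      simp
    rw [this]
    exact ofReal_mem_closure_sectorS le_rfl (norm_nonneg _)
  · set θ := Complex.arg w
    let f : ℝ → ℂ := fun s => (‖w‖ : ℂ) * Complex.exp (((s * θ : ℝ) : ℂ) * Complex.I)
    have hf : Continuous f := by fun_prop
    have hmaps : Set.MapsTo f (Set.Ico 0 1) (sectorS ω) := by
      intro s hs
      have hlt : |s * θ| < ω := by
        rw [abs_mul, abs_of_nonneg hs.1]
        nlinarith [hs.1, hs.2, abs_nonneg θ]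
      have hlt' := abs_lt.1 (hlt.trans hω')
      rw [sectorS, if_neg hpos.ne']
      refine ⟨mul_ne_zero (by simpa using hw0) (Complex.exp_ne_zero _), ?_⟩
      change |Complex.arg ((‖w‖ : ℂ) * Complex.exp (((s * θ : ℝ) : ℂ) * Complex.I))| < ω
      rwa [Complex.arg_real_mul _ (norm_pos_iff.2 hw0), Complex.arg_exp_mul_I, (toIocMod_eq_self _).2 ⟨hlt'.1, by linarith [hlt'.2]⟩]
    have h1 : (1 : ℝ) ∈ closure (Set.Ico (0 : ℝ) 1) := by
      rw [closure_Ico zero_ne_one]; simp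
    have h2 := map_mem_closure hf h1 hmaps
    have h3 : f 1 = w := by
      simp only [f, one_mul]; exact Complex.norm_mul_exp_arg_mul_I w
    rwa [h3] at h2

theorem cos_mul_norm_le_re_of_mem_closure_sectorS {ω : ℝ} (hω : 0 < ω) (hω' : ω ≤ Real.pi)
    {w : ℂ} (hw : w ∈ closure (sectorS ω)) : Real.cos ω * ‖w‖ ≤ w.re := by
  have hcl : IsClosed {z : ℂ | Real.cos ω * ‖z‖ ≤ z.re} :=
    isClosed_le (by fun_prop) Complex.continuous_re
  refine closure_minimal (fun z hz => ?_) hcl hw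
  rw [sectorS, if_neg hω.ne'] at hz
  have h1 : Real.cos ω ≤ Real.cos (Complex.arg z) := by
    rw [← Real.cos_abs (Complex.arg z)]
    exact Real.cos_le_cos_of_nonneg_of_le_pi (abs_nonneg _) hω' hz.2.le
  have h2 : z.re = Real.cos (Complex.arg z) * ‖z‖ := by
    rw [Complex.cos_arg hz.1, div_mul_cancel₀ _ (norm_ne_zero_iff.2 hz.1)]
  change Real.cos ω * ‖z‖ ≤ z.re
  rw [h2]
  gcongr

theorem norm_mul_re_sub_ofReal_le (w : ℂ) {t : ℝ} (ht : 0 ≤ t) :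
    ‖w‖ * (w - t).re ≤ w.re * ‖w - t‖ := by
  have hn : ‖w‖ ≤ ‖w - t‖ + t := by
    calc ‖w‖ = ‖(w - t) + (t : ℂ)‖ := by ring_nf
      _ ≤ ‖w - t‖ + ‖(t : ℂ)‖ := norm_add_le _ _
      _ = _ := by rw [Complex.norm_real, Real.norm_of_nonneg ht]
  have hn' : ‖w - t‖ ≤ ‖w‖ + t := by
    calc ‖w - t‖ ≤ ‖w‖ + ‖(t : ℂ)‖ := norm_sub_le _ _
      _ = _ := by rw [Complex.norm_real, Real.norm_of_nonneg ht]
  have hre := abs_le.1 (Complex.abs_re_le_norm w)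
  have hw := norm_nonneg w
  simp only [Complex.sub_re, Complex.ofReal_re]
  nlinarith [mul_nonneg ht hw, mul_nonneg ht (sub_nonneg.2 hre.2)]

theorem exists_sector_disjoint_ray {ω : ℝ} (hω : 0 ≤ ω) (hω' : ω < Real.pi) {w : ℂ}
    (hw : w ∉ closure (sectorS ω)) :
    ∃ ω', ω < ω' ∧ ω' < Real.pi ∧ ∀ t : ℝ, 0 ≤ t → w - t ∉ closure (sectorS ω') := by
  have harg : ω < |Complex.arg w| := by
    by_contra! h
    exact hw (mem_closure_sectorS_of_abs_arg_le hω' h)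
  have hw0 : w ≠ 0 := by
    rintro rfl
    simp at harg
    linarith
  have hle := Complex.abs_arg_le_pi w
  obtain ⟨ω', h1, h2⟩ := exists_between harg
  refine ⟨ω', h1, h2.trans_le hle, fun t ht hmem => ?_⟩
  have h3 := cos_mul_norm_le_re_of_mem_closure_sectorS (hω.trans_lt h1) (h2.le.trans hle) hmem
  have h4 : Real.cos (Complex.arg w) < Real.cos ω' := by
    rw [← Real.cos_abs (Complex.arg w)]
    exact Real.cos_lt_cos_of_nonneg_of_le_pi (hω.trans h1.le) hle h2
  have h5 : w.re = Real.cos (Complex.arg w) * ‖w‖ := by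
    rw [Complex.cos_arg hw0, div_mul_cancel₀ _ (norm_ne_zero_iff.2 hw0)]
  have h6 := norm_mul_re_sub_ofReal_le w ht
  have hwp : 0 < ‖w‖ := norm_pos_iff.2 hw0
  have hne : w - t ≠ 0 := by
    intro h
    have h7 : w = (t : ℂ) := sub_eq_zero.1 h
    exact hw (h7 ▸ ofReal_mem_closure_sectorS hω ht)
  have hp : 0 < ‖w - t‖ := norm_pos_iff.2 hne
  rw [h5] at h6
  have h8 : (w - t).re ≤ Real.cos (Complex.arg w) * ‖w - t‖ := by
    refine le_of_mul_le_mul_left ?_ hwp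
    linarith
  have := mul_lt_mul_of_pos_right h4 hp
  linarith

theorem sectorS_subset {ω ω' : ℝ} (h : 0 ≤ ω) (hω : ω < ω') : sectorS ω ⊆ sectorS ω' := by
  intro z hz
  have hne : ω' ≠ 0 := (h.trans_lt hω).ne'
  rw [sectorS] at hz ⊢
  rw [if_neg hne]
  split_ifs at hz with h0
  · obtain ⟨x, hx, rfl⟩ := hz
    have hx' : (0 : ℝ) < x := hx
    refine ⟨Complex.ofReal_ne_zero.2 hx'.ne', ?_⟩
    rw [Complex.arg_ofReal_of_nonneg hx'.le, abs_zero]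
    linarith
  · exact ⟨hz.1, hz.2.trans hω⟩

theorem exists_one_add_le_mul_norm_sub {ω : ℝ} (hω : 0 ≤ ω) {w : ℂ}
    (hw : w ∉ closure (sectorS ω)) :
    ∃ K : ℝ, 0 ≤ K ∧ ∀ t : ℝ, 0 ≤ t → 1 + t ≤ K * ‖w - t‖ := by
  obtain ⟨d, hd, hball⟩ := Metric.isOpen_iff.1 isClosed_closure.isOpen_compl w hw
  refine ⟨(1 + ‖w‖) / d + 1, by positivity, fun t ht => ?_⟩
  have h1 : d ≤ ‖w - t‖ := by
    by_contra! h
    have hmem : (t : ℂ) ∈ Metric.ball w d := by rwa [mem_ball_iff_norm']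
    exact hball hmem (ofReal_mem_closure_sectorS hω ht)
  have h2 : t ≤ ‖w‖ + ‖w - t‖ := by
    calc t = ‖(t : ℂ)‖ := by rw [Complex.norm_real, Real.norm_of_nonneg ht]
      _ = ‖w - (w - t)‖ := by ring_nf
      _ ≤ _ := norm_sub_le _ _
  have h3 : 1 + ‖w‖ ≤ (1 + ‖w‖) / d * ‖w - t‖ := by
    rw [div_mul_eq_mul_div, le_div_iff₀ hd]
    gcongr
  linarith

/-- The ray `z - [0,∞)` lies in the resolvent set of `A`, and the resolvent decays along it
at the rate `C / (1 + t)`. -/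
def ResolventDecay (A : H →ₗ.[ℂ] H) (z : ℂ) (C : ℝ) : Prop :=
  ∀ t : ℝ, 0 ≤ t → z - t ∈ resolventSetP A ∧ (1 + t) * ‖res A (z - t)‖ ≤ C

theorem add_ofReal_notMem_closure_sectorS {t0 ω : ℝ} {z : ℂ} (hz : z ∈ offSector t0 ω) :
    z + t0 ∉ closure (sectorS ω) := by
  intro h
  refine hz ?_
  have h1 := map_mem_closure (f := fun w : ℂ => -(t0 : ℂ) + w) (by fun_prop) h
    (t := shiftedSector t0 ω) (fun w hw => ⟨w, hw, rfl⟩)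
  simpa using h1

theorem IsSectorialP.exists_resolventDecay {A : H →ₗ.[ℂ] H} {t0 ω : ℝ} (hω : 0 ≤ ω)
    (hω' : ω < Real.pi) (hA : IsSectorialP (shiftP A (t0 : ℂ)) ω) {z : ℂ}
    (hz : z ∈ offSector t0 ω) : ∃ C, ResolventDecay A z C := by
  have hw := add_ofReal_notMem_closure_sectorS hz
  obtain ⟨ω', h1, h2, h3⟩ := exists_sector_disjoint_ray hω hω' hw
  obtain ⟨K, hK, hK'⟩ := exists_one_add_le_mul_norm_sub hω hw
  obtain ⟨M, hM⟩ := hA.2 ω' h1 h2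
  refine ⟨K * M, fun t ht => ?_⟩
  have he : z - t = (z + t0 - t) - t0 := by ring
  constructor
  · rw [he, ← mem_resolventSetP_shiftP_iff]
    by_contra h
    exact h3 t ht (closure_mono (sectorS_subset hω h1) (hA.1 h))
  · rw [he, ← res_shiftP]
    calc (1 + t) * ‖res (shiftP A t0) (z + t0 - t)‖
        ≤ K * ‖z + t0 - t‖ * ‖res (shiftP A t0) (z + t0 - t)‖ := by
          gcongr; exact hK' t ht
      _ = K * (‖z + t0 - t‖ * ‖res (shiftP A t0) (z + t0 - t)‖) := by ring
      _ ≤ K * M := by gcongr; exact hM _ (h3 t ht)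

theorem IsPositiveTypeP.exists_resolventDecay {A : H →ₗ.[ℂ] H} {t0 : ℝ}
    (hA : IsPositiveTypeP (shiftP A (t0 : ℂ))) : ∃ C, ResolventDecay A (-(t0 : ℂ)) C := by
  obtain ⟨h1, M, hM⟩ := hA
  refine ⟨M, fun t ht => ?_⟩
  have he : -(t0 : ℂ) - t = -(t : ℂ) - t0 := by ring
  rw [he, ← mem_resolventSetP_shiftP_iff, ← res_shiftP]
  exact ⟨by simpa using h1 (-t) (by linarith), hM t ht⟩

theorem conj_mem_offSector {t0 ω : ℝ} {z : ℂ} (hz : z ∈ offSector t0 ω) :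
    starRingEnd ℂ z ∈ offSector t0 ω := by
  intro h
  refine hz ?_
  have h1 := map_mem_closure Complex.continuous_conj h (t := shiftedSector t0 ω) ?_
  · simpa using h1
  rintro _ ⟨w, hw, rfl⟩
  refine ⟨starRingEnd ℂ w, ?_, by simp⟩
  rw [sectorS] at hw ⊢
  split_ifs at hw ⊢ with h0
  · obtain ⟨x, hx, rfl⟩ := hw
    exact ⟨x, hx, by simp⟩
  · refine ⟨by simpa using hw.1, ?_⟩
    rw [Complex.arg_conj]
    split_ifs with hpi
    · rw [← hpi]; exact hw.2
    · rw [abs_neg]; exact hw.2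

theorem ResolventDecay.adjoint {A : H →ₗ.[ℂ] H} (hA : Dense (A.domain : Set H)) {z : ℂ} {C : ℝ}
    (h : ResolventDecay A z C) : ResolventDecay A.adjoint (starRingEnd ℂ z) C := by
  intro t ht
  have h1 := (isResolvent_res (h t ht).1).adjoint hA
  have he : starRingEnd ℂ (z - t) = starRingEnd ℂ z - t := by simp
  rw [he] at h1
  refine ⟨⟨_, h1⟩, ?_⟩
  rw [h1.res_eq, LinearIsometryEquiv.norm_map]
  exact (h t ht).2

theorem integrableOn_and_integral_inv_sqrt_mul_inv_add {a : ℝ} (ha : 0 < a) :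
    IntegrableOn (fun t : ℝ => (√t)⁻¹ * (a ^ 2 + t)⁻¹) (Set.Ioi 0) ∧
      ∫ t in Set.Ioi (0 : ℝ), (√t)⁻¹ * (a ^ 2 + t)⁻¹ = Real.pi / a := by
  let g : ℝ → ℝ := fun t => 2 / a * Real.arctan (√t / a)
  have hcont : ContinuousWithinAt g (Set.Ici 0) 0 :=
    Continuous.continuousWithinAt <|
      continuous_const.mul (Real.continuous_arctan.comp (Real.continuous_sqrt.div_const a))
  have hderiv : ∀ t ∈ Set.Ioi (0 : ℝ), HasDerivAt g ((√t)⁻¹ * (a ^ 2 + t)⁻¹) t := by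
    intro t ht
    have ht' : (0 : ℝ) < t := ht
    have h := ((((Real.hasDerivAt_sqrt ht'.ne').div_const a).arctan)).const_mul (2 / a)
    convert! h using 1
    have hs : 0 < √t := Real.sqrt_pos.2 ht'
    rw [div_pow, Real.sq_sqrt ht'.le]
    field_simp
  have hpos : ∀ t ∈ Set.Ioi (0 : ℝ), 0 ≤ (√t)⁻¹ * (a ^ 2 + t)⁻¹ := fun t ht => by
    have ht' : (0 : ℝ) < t := ht
    positivity
  have hlim : Tendsto g atTop (nhds (Real.pi / a)) := by
    have h1 : Tendsto (fun t : ℝ => √t / a) atTop atTop :=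
      Real.tendsto_sqrt_atTop.atTop_div_const ha
    have h2 : Tendsto (fun t : ℝ => Real.arctan (√t / a)) atTop (nhds (Real.pi / 2)) :=
      (Real.tendsto_arctan_atTop.mono_right nhdsWithin_le_nhds).comp h1
    have h3 := h2.const_mul (2 / a)
    have h4 : 2 / a * (Real.pi / 2) = Real.pi / a := by ring
    rwa [h4] at h3
  refine ⟨integrableOn_Ioi_deriv_of_nonneg hcont hderiv hpos hlim, ?_⟩
  rw [integral_Ioi_of_hasDerivAt_of_nonneg hcont hderiv hpos hlim]
  simp [g]

theorem integrableOn_Ioi_of_norm_le_inv_sqrt {f : ℝ → H →L[ℂ] H} {C : ℝ}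
    (hf : ContinuousOn f (Set.Ioi 0))
    (hb : ∀ t : ℝ, 0 < t → ‖f t‖ ≤ C * ((√t)⁻¹ * (1 + t)⁻¹)) :
    IntegrableOn f (Set.Ioi 0) := by
  have h := (integrableOn_and_integral_inv_sqrt_mul_inv_add one_pos).1.const_mul C
  refine Integrable.mono' h (hf.aestronglyMeasurable measurableSet_Ioi) ?_
  refine (ae_restrict_iff' measurableSet_Ioi).2 (Eventually.of_forall fun t ht => ?_)
  simpa using hb t ht

theorem sqrt_mul_inv_one_add_le {t : ℝ} (ht : 0 < t) :
    √t * ((1 + t)⁻¹ * (1 + t)⁻¹) ≤ (√t)⁻¹ * (1 + t)⁻¹ := by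
  have hs : 0 < √t := Real.sqrt_pos.2 ht
  have h1 : √t * (1 + t)⁻¹ ≤ (√t)⁻¹ := by
    rw [← div_eq_mul_inv, div_le_iff₀ (by positivity), inv_mul_eq_div, le_div_iff₀ hs,
      Real.mul_self_sqrt ht.le]
    linarith
  rw [← mul_assoc]
  gcongr

theorem continuousOn_sqrt_inv_ofReal :
    ContinuousOn (fun t : ℝ => ((√t : ℝ) : ℂ)⁻¹) (Set.Ioi 0) :=
  ContinuousOn.inv₀ (by fun_prop) fun t ht =>
    Complex.ofReal_ne_zero.2 (Real.sqrt_pos.2 ht).ne'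

theorem norm_sqrt_inv_ofReal (t : ℝ) : ‖((√t : ℝ) : ℂ)⁻¹‖ = (√t)⁻¹ := by
  rw [norm_inv, Complex.norm_real, Real.norm_of_nonneg (Real.sqrt_nonneg t)]

namespace ResolventDecay

variable {A : H →ₗ.[ℂ] H} {z w : ℂ} {C C' : ℝ}

theorem isResolvent (h : ResolventDecay A z C) {t : ℝ} (ht : 0 ≤ t) :
    IsResolvent A (z - t) (res A (z - t)) :=
  isResolvent_res (h t ht).1

theorem isResolvent_self (h : ResolventDecay A z C) : IsResolvent A z (res A z) := by
  simpa using h.isResolvent le_rfl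

theorem nonneg (h : ResolventDecay A z C) : 0 ≤ C := by
  have := (h 0 le_rfl).2
  refine le_trans ?_ this
  positivity

theorem norm_le (h : ResolventDecay A z C) {t : ℝ} (ht : 0 ≤ t) :
    ‖res A (z - t)‖ ≤ C * (1 + t)⁻¹ := by
  rw [← div_eq_mul_inv, le_div_iff₀' (by positivity)]
  exact (h t ht).2

theorem norm_le_const (h : ResolventDecay A z C) {t : ℝ} (ht : 0 ≤ t) :
    ‖res A (z - t)‖ ≤ C := by
  refine (h.norm_le ht).trans (mul_le_of_le_one_right h.nonneg ?_)
  exact inv_le_one_of_one_le₀ (by linarith)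

theorem sub_ofReal (h : ResolventDecay A z C) {s : ℝ} (hs : 0 ≤ s) :
    ResolventDecay A (z - s) C := by
  intro t ht
  have he : z - s - t = z - ((s + t : ℝ) : ℂ) := by push_cast; ring
  rw [he]
  refine ⟨(h _ (by positivity)).1, le_trans ?_ (h (s + t) (by positivity)).2⟩
  gcongr
  linarith

theorem nearby (h : ResolventDecay A z C) (hw : ‖w - z‖ * C ≤ 1 / 2) :
    ResolventDecay A w (2 * C) := by
  intro t ht
  have h1 : ‖(w - t) - (z - t)‖ * ‖res A (z - t)‖ ≤ 1 / 2 := by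
    rw [sub_sub_sub_cancel_right]
    refine le_trans ?_ hw
    gcongr
    exact h.norm_le_const ht
  have h2 := mem_resolventSetP_of_norm_le (h t ht).1 h1
  refine ⟨h2, ?_⟩
  have h3 := (h.isResolvent ht).norm_le_two_mul (isResolvent_res h2) h1
  calc (1 + t) * ‖res A (w - t)‖ ≤ (1 + t) * (2 * ‖res A (z - t)‖) := by gcongr
    _ = 2 * ((1 + t) * ‖res A (z - t)‖) := by ring
    _ ≤ 2 * C := by gcongr; exact (h t ht).2

theorem hasDerivAt_ray (h : ResolventDecay A z C) {t : ℝ} (ht : 0 ≤ t) :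
    HasDerivAt (fun t : ℝ => res A (z - t)) (-(res A (z - t) * res A (z - t))) t := by
  have h1 : HasDerivAt (fun t : ℝ => z - (t : ℂ)) (-1) t := by
    simpa using (Complex.ofRealCLM.hasDerivAt (x := t)).const_sub z
  simpa [Function.comp_def] using HasDerivAt.scomp t (hasDerivAt_res (h t ht).1) h1

theorem continuousOn (h : ResolventDecay A z C) :
    ContinuousOn (fun t : ℝ => res A (z - t)) (Set.Ioi 0) := fun _ ht =>
  (h.hasDerivAt_ray (le_of_lt ht)).continuousAt.continuousWithinAt

theorem integrableOn_negSqrt (h : ResolventDecay A z C) :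
    IntegrableOn (fun t : ℝ => ((√t : ℝ) : ℂ)⁻¹ • res A (z - t)) (Set.Ioi 0) := by
  refine integrableOn_Ioi_of_norm_le_inv_sqrt (C := C)
    (continuousOn_sqrt_inv_ofReal.smul h.continuousOn) fun t ht => ?_
  rw [norm_smul, norm_sqrt_inv_ofReal]
  calc (√t)⁻¹ * ‖res A (z - t)‖ ≤ (√t)⁻¹ * (C * (1 + t)⁻¹) := by
        gcongr; exact h.norm_le ht.le
    _ = _ := by ring

theorem norm_mul_le (h : ResolventDecay A z C) (h' : ResolventDecay A w C') {t : ℝ}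
    (ht : 0 ≤ t) :
    ‖res A (z - t) * res A (w - t)‖ ≤ C * C' * ((1 + t)⁻¹ * (1 + t)⁻¹) := by
  refine (_root_.norm_mul_le _ _).trans ?_
  calc ‖res A (z - t)‖ * ‖res A (w - t)‖ ≤ (C * (1 + t)⁻¹) * (C' * (1 + t)⁻¹) := by
        have := h.nonneg
        gcongr
        · exact h.norm_le ht
        · exact h'.norm_le ht
    _ = _ := by ring

theorem integrableOn_sqrt_smul_mul (h : ResolventDecay A z C) (h' : ResolventDecay A w C') :
    IntegrableOn (fun t : ℝ => ((√t : ℝ) : ℂ) • (res A (z - t) * res A (w - t)))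
      (Set.Ioi 0) := by
  refine integrableOn_Ioi_of_norm_le_inv_sqrt (C := C * C')
    ((by fun_prop : Continuous fun t : ℝ => ((√t : ℝ) : ℂ)).continuousOn.smul
      (h.continuousOn.mul h'.continuousOn)) fun t ht => ?_
  rw [norm_smul, Complex.norm_real, Real.norm_of_nonneg (Real.sqrt_nonneg t)]
  have := h.nonneg
  have := h'.nonneg
  calc √t * ‖res A (z - t) * res A (w - t)‖
      ≤ √t * (C * C' * ((1 + t)⁻¹ * (1 + t)⁻¹)) := by gcongr; exact h.norm_mul_le h' ht.le
    _ = C * C' * (√t * ((1 + t)⁻¹ * (1 + t)⁻¹)) := by ring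
    _ ≤ _ := mul_le_mul_of_nonneg_left (sqrt_mul_inv_one_add_le ht) (by positivity)

theorem hasDerivAt_negSqrt_integral (h : ResolventDecay A z C) :
    IntegrableOn (fun t : ℝ => ((√t : ℝ) : ℂ)⁻¹ • (res A (z - t) * res A (z - t)))
      (Set.Ioi 0) ∧
    HasDerivAt (negSqrt A) ((Real.pi : ℂ)⁻¹ • ∫ t in Set.Ioi (0 : ℝ),
      ((√t : ℝ) : ℂ)⁻¹ • (res A (z - t) * res A (z - t))) z := by
  have hC := h.nonneg
  have hball : ∀ w ∈ Metric.ball z (1 / (2 * (C + 1))), ResolventDecay A w (2 * C) := by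
    intro w hw
    refine h.nearby ?_
    rw [mem_ball_iff_norm] at hw
    have h1 : ‖w - z‖ * C ≤ 1 / (2 * (C + 1)) * (C + 1) := by gcongr; linarith
    refine h1.trans (le_of_eq ?_)
    field_simp
  have hnhds : Metric.ball z (1 / (2 * (C + 1))) ∈ nhds z :=
    Metric.ball_mem_nhds _ (by positivity)
  have key := hasDerivAt_integral_of_dominated_loc_of_deriv_le
    (μ := volume.restrict (Set.Ioi (0 : ℝ))) (𝕜 := ℂ) (x₀ := z)
    (F := fun w t => ((√t : ℝ) : ℂ)⁻¹ • res A (w - t))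
    (F' := fun w t => ((√t : ℝ) : ℂ)⁻¹ • (res A (w - t) * res A (w - t)))
    (bound := fun t => (2 * C * (2 * C)) * ((√t)⁻¹ * (1 ^ 2 + t)⁻¹)) hnhds
    (eventually_of_mem hnhds fun w hw =>
      (hball w hw).integrableOn_negSqrt.aestronglyMeasurable)
    h.integrableOn_negSqrt
    ((continuousOn_sqrt_inv_ofReal.smul (h.continuousOn.mul h.continuousOn)).aestronglyMeasurable
      measurableSet_Ioi)
    ?_ ((integrableOn_and_integral_inv_sqrt_mul_inv_add one_pos).1.const_mul _) ?_
  · exact ⟨key.1, key.2.fun_const_smul _⟩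
  · refine (ae_restrict_iff' measurableSet_Ioi).2 (Eventually.of_forall fun t ht w hw => ?_)
    have ht' : (0 : ℝ) < t := ht
    rw [norm_smul, norm_sqrt_inv_ofReal]
    calc (√t)⁻¹ * ‖res A (w - t) * res A (w - t)‖
        ≤ (√t)⁻¹ * (2 * C * (2 * C) * ((1 + t)⁻¹ * (1 + t)⁻¹)) := by
          gcongr; exact (hball w hw).norm_mul_le (hball w hw) ht'.le
      _ ≤ (√t)⁻¹ * (2 * C * (2 * C) * (1 * (1 + t)⁻¹)) := by
          gcongr; exact inv_le_one_of_one_le₀ (by linarith)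
      _ = _ := by ring
  · refine (ae_restrict_iff' measurableSet_Ioi).2 (Eventually.of_forall fun t ht w hw => ?_)
    have h1 := hasDerivAt_res (hball w hw t (le_of_lt ht)).1
    exact (h1.comp_sub_const w (t : ℂ)).fun_const_smul _

theorem integral_sqrt_smul_sq (h : ResolventDecay A z C) :
    ∫ t in Set.Ioi (0 : ℝ), ((√t : ℝ) : ℂ) • (res A (z - t) * res A (z - t)) =
      (1 / 2 : ℂ) • ∫ t in Set.Ioi (0 : ℝ), ((√t : ℝ) : ℂ)⁻¹ • res A (z - t) := by
  have hderiv : ∀ t ∈ Set.Ioi (0 : ℝ), HasDerivAt (fun t : ℝ => √t • res A (z - t))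
      ((1 / 2 : ℂ) • (((√t : ℝ) : ℂ)⁻¹ • res A (z - t))
        - ((√t : ℝ) : ℂ) • (res A (z - t) * res A (z - t))) t := by
    intro t ht
    have ht' : (0 : ℝ) < t := ht
    have h1 := (Real.hasDerivAt_sqrt ht'.ne').smul (h.hasDerivAt_ray ht'.le)
    convert! h1 using 1
    rw [smul_neg, neg_add_eq_sub, ← Complex.coe_smul (√t), ← Complex.coe_smul (1 / (2 * √t)),
      smul_smul]
    congr 2
    push_cast
    ring
  have hint1 : IntegrableOn (fun t : ℝ => (1 / 2 : ℂ) • (((√t : ℝ) : ℂ)⁻¹ • res A (z - t)))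
      (Set.Ioi 0) := h.integrableOn_negSqrt.smul (1 / 2 : ℂ)
  have hint2 := h.integrableOn_sqrt_smul_mul h
  have hlim : Tendsto (fun t : ℝ => √t • res A (z - t)) atTop (nhds 0) := by
    have h0 : Tendsto (fun t : ℝ => C * (√t)⁻¹) atTop (nhds 0) := by
      simpa using (tendsto_inv_atTop_zero.comp Real.tendsto_sqrt_atTop).const_mul C
    refine squeeze_zero_norm' ?_ h0
    filter_upwards [eventually_gt_atTop 0] with t ht
    have hs : 0 < √t := Real.sqrt_pos.2 ht
    rw [norm_smul, Real.norm_of_nonneg hs.le, ← div_eq_mul_inv, le_div_iff₀ hs]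
    calc √t * ‖res A (z - t)‖ * √t = (√t * √t) * ‖res A (z - t)‖ := by ring
      _ = t * ‖res A (z - t)‖ := by rw [Real.mul_self_sqrt ht.le]
      _ ≤ (1 + t) * ‖res A (z - t)‖ := by gcongr; linarith
      _ ≤ C := (h t ht.le).2
  have hcont : ContinuousWithinAt (fun t : ℝ => √t • res A (z - t)) (Set.Ici 0) 0 :=
    (Real.continuous_sqrt.continuousAt.smul
      (h.hasDerivAt_ray le_rfl).continuousAt).continuousWithinAt
  have := integral_Ioi_of_hasDerivAt_of_tendsto hcont hderiv (hint1.sub hint2) hlim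
  rw [integral_sub hint1 hint2, integral_smul] at this
  simp only [Real.sqrt_zero, zero_smul, sub_zero] at this
  exact (sub_eq_zero.1 this).symm

theorem hasDerivAt_negSqrt (h : ResolventDecay A z C) :
    HasDerivAt (negSqrt A) ((1 / 2 : ℂ) • (res A z * negSqrt A z)) z := by
  obtain ⟨hint, hder⟩ := h.hasDerivAt_negSqrt_integral
  convert hder using 1
  have hI := h.integrableOn_negSqrt
  have h1 := integral_const_mul_of_integrable hI (c := res A z)
  have h2 := integral_const_mul_of_integrable (h.integrableOn_sqrt_smul_mul h) (c := res A z)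
  have h3 : ∫ t in Set.Ioi (0 : ℝ), res A z *
        (((√t : ℝ) : ℂ) • (res A (z - t) * res A (z - t))) =
      ∫ t in Set.Ioi (0 : ℝ), (res A z * (((√t : ℝ) : ℂ)⁻¹ • res A (z - t))
        - ((√t : ℝ) : ℂ)⁻¹ • (res A (z - t) * res A (z - t))) := by
    refine setIntegral_congr_fun measurableSet_Ioi fun t ht => ?_
    have ht' : (0 : ℝ) < t := ht
    have h4 := h.isResolvent_self.sub_eq (h.isResolvent ht'.le)
    have hs : ((√t : ℝ) : ℂ) ≠ 0 := Complex.ofReal_ne_zero.2 (Real.sqrt_pos.2 ht').ne'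
    have hts : (t : ℂ) = ((√t : ℝ) : ℂ) * ((√t : ℝ) : ℂ) := by
      rw [← Complex.ofReal_mul, Real.mul_self_sqrt ht'.le]
    change res A z * (((√t : ℝ) : ℂ) • (res A (z - t) * res A (z - t))) =
      res A z * (((√t : ℝ) : ℂ)⁻¹ • res A (z - t))
        - ((√t : ℝ) : ℂ)⁻¹ • (res A (z - t) * res A (z - t))
    rw [mul_smul_comm, mul_smul_comm, ← smul_sub, ← sub_mul, h4, smul_mul_assoc, smul_smul,
      mul_assoc]
    congr 1
    rw [sub_sub_cancel, hts]
    field_simp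
  have hI' : IntegrableOn (fun t : ℝ => res A z * (((√t : ℝ) : ℂ)⁻¹ • res A (z - t)))
      (Set.Ioi 0) := hI.const_mul (res A z)
  rw [integral_sub hI' hint, h1, h2, h.integral_sqrt_smul_sq] at h3
  rw [← sub_eq_iff_eq_add.2 (sub_eq_iff_eq_add'.1 h3.symm), negSqrt, mul_smul_comm, mul_smul_comm,
    smul_comm]
  congr 1
  module

theorem commute_negSqrt (h : ResolventDecay A z C) {X : H →L[ℂ] H}
    (hX : ∀ t : ℝ, 0 ≤ t → Commute X (res A (z - t))) : Commute X (negSqrt A z) := by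
  rw [negSqrt]
  refine Commute.smul_right ?_ _
  rw [commute_iff_eq, ← integral_const_mul_of_integrable h.integrableOn_negSqrt,
    ← integral_mul_const_of_integrable h.integrableOn_negSqrt]
  refine setIntegral_congr_fun measurableSet_Ioi fun t ht => ?_
  exact ((hX t (le_of_lt ht)).smul_right _).eq

theorem commute_res_negSqrt (h : ResolventDecay A z C) (hw : w ∈ resolventSetP A) :
    Commute (res A w) (negSqrt A z) :=
  h.commute_negSqrt fun _ ht => (isResolvent_res hw).commute (h.isResolvent ht)

theorem commute_negSqrt_negSqrt (h : ResolventDecay A z C) (h' : ResolventDecay A w C') :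
    Commute (negSqrt A w) (negSqrt A z) :=
  h.commute_negSqrt fun t ht => (h'.commute_res_negSqrt (h t ht).1).symm

theorem hasDerivAt_negSqrt_ray (h : ResolventDecay A z C) {s : ℝ} (hs : 0 ≤ s) :
    HasDerivAt (fun s : ℝ => negSqrt A (z - s))
      (-((1 / 2 : ℂ) • (res A (z - s) * negSqrt A (z - s)))) s := by
  have h1 : HasDerivAt (fun t : ℝ => z - (t : ℂ)) (-1) s := by
    simpa using (Complex.ofRealCLM.hasDerivAt (x := s)).const_sub z
  have h2 := HasDerivAt.scomp s (h.sub_ofReal hs).hasDerivAt_negSqrt h1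
  rw [neg_one_smul] at h2
  exact h2

/-- Formally `(A - z + s)^{-1/2} (A - z + s)^{-1/2} (A - z + s)` does not depend on `s`. Applying
`(A - z)⁻¹` gives this identity between bounded operators. -/
theorem negSqrt_sq_mul_one_add (h : ResolventDecay A z C) {s : ℝ} (hs : 0 ≤ s) :
    negSqrt A (z - s) * negSqrt A (z - s) * (1 + s • res A z) = negSqrt A z * negSqrt A z := by
  let G : ℝ → H →L[ℂ] H := fun s =>
    negSqrt A (z - s) * negSqrt A (z - s) * (1 + s • res A z)
  have hderiv : ∀ s : ℝ, 0 ≤ s → HasDerivAt G 0 s := by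
    intro s hs
    have h1 := h.hasDerivAt_negSqrt_ray hs
    have h2 : HasDerivAt (fun s : ℝ => 1 + s • res A z) (res A z) s := by
      simpa using ((hasDerivAt_id s).smul_const (res A z)).const_add (1 : H →L[ℂ] H)
    have h3 := (h1.mul h1).mul h2
    convert! h3 using 1
    have hs' := h.sub_ofReal hs
    set N := negSqrt A (z - s)
    set R := res A (z - s)
    have hRN : R * N = N * R := hs'.commute_res_negSqrt (h s hs).1
    have hR : R * res A z = res A z * R :=
      (h.isResolvent hs).commute h.isResolvent_self
    have hsub : s • (R * res A z) = res A z - R := by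
      have := h.isResolvent_self.sub_eq (h.isResolvent hs)
      rw [sub_sub_cancel, ← hR, Complex.coe_smul] at this
      exact this.symm
    have h4 : -((1 / 2 : ℂ) • (R * N)) * N + N * -((1 / 2 : ℂ) • (R * N)) = -(N * N * R) := by
      rw [neg_mul, mul_neg, smul_mul_assoc, mul_smul_comm, hRN, mul_assoc N R N, hRN, ← mul_assoc]
      module
    rw [h4, neg_mul, mul_assoc (N * N), mul_add, mul_one, mul_smul_comm, hsub,
      add_sub_cancel]
    exact (neg_add_cancel _).symm
  have hconst := constant_of_has_deriv_right_zero (f := G) (a := 0) (b := s)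
    (fun x hx => (hderiv x hx.1).continuousAt.continuousWithinAt)
    (fun x hx => (hderiv x hx.1).hasDerivWithinAt) s ⟨hs, le_rfl⟩
  simpa [G] using hconst

theorem norm_smul_negSqrt_mul_res_sub_le (h : ResolventDecay A z C) {a : ℝ} (ha : 0 < a) :
    ‖(a : ℂ) • (negSqrt A (z - (a ^ 2 : ℝ)) * res A z) - res A z‖ ≤ C * (a ^ 2)⁻¹ := by
  obtain ⟨hwi, hw⟩ := integrableOn_and_integral_inv_sqrt_mul_inv_add ha
  have ha2 : (0 : ℝ) ≤ a ^ 2 := by positivity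
  have h' := h.sub_ofReal ha2
  have hC := h.nonneg
  have hpi := Real.pi_pos
  set R : ℝ → H →L[ℂ] H := fun t => res A (z - (a ^ 2 : ℝ) - t) with hR
  let k : ℝ → ℝ := fun t => (√t)⁻¹ * (a ^ 2 + t)⁻¹
  have hpt : ∀ t ∈ Set.Ioi (0 : ℝ), (((√t : ℝ) : ℂ)⁻¹ • R t) * res A z =
      k t • res A z - k t • R t := by
    intro t ht
    have ht' : (0 : ℝ) < t := ht
    have h1 := h.isResolvent_self.sub_eq (h'.isResolvent ht'.le)
    have h2 := ((h'.isResolvent ht'.le).commute h.isResolvent_self).eq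
    rw [← smul_sub, h1, smul_mul_assoc, h2, ← Complex.coe_smul, smul_smul]
    congr 1
    have h3 : ((a : ℂ) ^ 2 + t) ≠ 0 := by
      have : (0 : ℝ) < a ^ 2 + t := by positivity
      exact_mod_cast this.ne'
    simp only [k]
    push_cast
    have h4 : z - (z - (a : ℂ) ^ 2 - t) = (a : ℂ) ^ 2 + t := by ring
    rw [h4, inv_mul_cancel_right₀ h3]
  have hi1 : IntegrableOn (fun t => k t • res A z) (Set.Ioi 0) := hwi.smul_const _
  have hnorm : ∀ t ∈ Set.Ioi (0 : ℝ), ‖k t • R t‖ ≤ C * (a ^ 2)⁻¹ * k t := by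
    intro t ht
    have ht' : (0 : ℝ) < t := ht
    have hk : 0 ≤ k t := by positivity
    have h1 : ‖R t‖ ≤ C * (a ^ 2)⁻¹ := by
      have h2 : R t = res A (z - ((a ^ 2 + t : ℝ) : ℂ)) := by
        simp only [hR]; congr 1; push_cast; ring
      rw [h2]
      refine (h.norm_le (by positivity)).trans ?_
      gcongr
      linarith
    rw [norm_smul, Real.norm_of_nonneg hk, mul_comm]
    gcongr
  have hkc : ContinuousOn k (Set.Ioi 0) := by
    refine ContinuousOn.mul ?_ ?_
    · exact ContinuousOn.inv₀ (by fun_prop) fun t ht => (Real.sqrt_pos.2 ht).ne'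
    · refine ContinuousOn.inv₀ (by fun_prop) fun t ht => ?_
      have ht' : (0 : ℝ) < t := ht
      positivity
  have hbi : IntegrableOn (fun t => C * (a ^ 2)⁻¹ * k t) (Set.Ioi 0) := hwi.const_mul _
  have hae : ∀ᵐ t ∂volume.restrict (Set.Ioi (0 : ℝ)), ‖k t • R t‖ ≤ C * (a ^ 2)⁻¹ * k t :=
    (ae_restrict_iff' measurableSet_Ioi).2 (Eventually.of_forall hnorm)
  have hi2 : IntegrableOn (fun t => k t • R t) (Set.Ioi 0) :=
    Integrable.mono' hbi
      ((hkc.smul h'.continuousOn).aestronglyMeasurable measurableSet_Ioi) hae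
  have hN : (a : ℂ) • (negSqrt A (z - (a ^ 2 : ℝ)) * res A z) - res A z =
      -((a / Real.pi) • ∫ t in Set.Ioi (0 : ℝ), k t • R t) := by
    rw [negSqrt, smul_mul_assoc, ← integral_mul_const_of_integrable h'.integrableOn_negSqrt,
      setIntegral_congr_fun measurableSet_Ioi hpt, integral_sub hi1 hi2, integral_smul_const, hw,
      smul_smul, ← Complex.ofReal_inv, ← Complex.ofReal_mul, Complex.coe_smul, smul_sub, smul_smul]
    have h5 : a * Real.pi⁻¹ * (Real.pi / a) = 1 := by field_simp
    rw [h5, one_smul, div_eq_mul_inv]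
    abel
  rw [hN, norm_neg, norm_smul, Real.norm_of_nonneg (by positivity)]
  calc a / Real.pi * ‖∫ t in Set.Ioi (0 : ℝ), k t • R t‖
      ≤ a / Real.pi * ∫ t in Set.Ioi (0 : ℝ), C * (a ^ 2)⁻¹ * k t := by
        gcongr
        exact norm_integral_le_of_norm_le hbi hae
    _ = C * (a ^ 2)⁻¹ := by
        rw [integral_const_mul, hw]
        field_simp

theorem negSqrt_mul_self (h : ResolventDecay A z C) : negSqrt A z * negSqrt A z = res A z := by
  let P : ℝ → H →L[ℂ] H := fun a => (a : ℂ) • (negSqrt A (z - (a ^ 2 : ℝ)) * res A z)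
  have hP : Tendsto P atTop (nhds (res A z)) := by
    rw [tendsto_iff_norm_sub_tendsto_zero]
    have h0 : Tendsto (fun a : ℝ => C * (a ^ 2)⁻¹) atTop (nhds 0) := by
      simpa using (tendsto_inv_atTop_zero.comp
        (tendsto_pow_atTop (α := ℝ) two_ne_zero)).const_mul C
    refine squeeze_zero' (Eventually.of_forall fun _ => norm_nonneg _) ?_ h0
    filter_upwards [eventually_gt_atTop 0] with a ha
    exact h.norm_smul_negSqrt_mul_res_sub_le ha
  have hQ : Tendsto (fun a : ℝ => ((a⁻¹ : ℝ) : ℂ) • P a) atTop (nhds 0) := by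
    have h1 : Tendsto (fun a : ℝ => ((a⁻¹ : ℝ) : ℂ)) atTop (nhds 0) := by
      have := (Complex.continuous_ofReal.tendsto 0).comp tendsto_inv_atTop_zero
      simpa [Function.comp_def] using this
    simpa using h1.smul hP
  have hlim := (hQ.mul hQ).add ((hP.mul hP).mul_const (res A z))
  have hev : ∀ᶠ a : ℝ in atTop, (((a⁻¹ : ℝ) : ℂ) • P a) * (((a⁻¹ : ℝ) : ℂ) • P a)
      + P a * P a * res A z = negSqrt A z * negSqrt A z * (res A z * res A z) := by
    filter_upwards [eventually_gt_atTop 0] with a ha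
    have ha2 : (0 : ℝ) ≤ a ^ 2 := by positivity
    have hac : (a : ℂ) ≠ 0 := Complex.ofReal_ne_zero.2 ha.ne'
    rw [← h.negSqrt_sq_mul_one_add ha2]
    have hc : res A z * negSqrt A (z - (a ^ 2 : ℝ)) = negSqrt A (z - (a ^ 2 : ℝ)) * res A z :=
      (h.sub_ofReal ha2).commute_res_negSqrt ⟨_, h.isResolvent_self⟩
    simp only [P]
    set N := negSqrt A (z - (a ^ 2 : ℝ))
    set R := res A z
    have h3 : N * R * (N * R) = N * N * (R * R) := by
      rw [mul_assoc N R, ← mul_assoc R N, hc]; simp only [mul_assoc]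
    rw [smul_smul, Complex.ofReal_inv, inv_mul_cancel₀ hac, one_smul, h3, smul_mul_smul_comm, h3,
      mul_add, mul_one, add_mul, mul_smul_comm, smul_mul_assoc, smul_mul_assoc,
      ← Complex.ofReal_mul, Complex.coe_smul, sq]
    simp only [mul_assoc]
  have heq := tendsto_nhds_unique (hlim.congr' hev) tendsto_const_nhds
  rw [mul_zero, zero_add] at heq
  have hc : res A z * (negSqrt A z * negSqrt A z) = negSqrt A z * negSqrt A z * res A z :=
    ((h.commute_res_negSqrt ⟨_, h.isResolvent_self⟩).mul_right
      (h.commute_res_negSqrt ⟨_, h.isResolvent_self⟩)).eq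
  have heq' : res A z * (res A z * (negSqrt A z * negSqrt A z)) =
      res A z * (res A z * res A z) := by
    rw [hc, ← mul_assoc, hc, mul_assoc, ← heq, mul_assoc]
  have hinj := h.isResolvent_self.injective
  ext x
  exact hinj (hinj (DFunLike.congr_fun heq' x))

theorem injective_negSqrt (h : ResolventDecay A z C) : Function.Injective (negSqrt A z) := by
  intro x y hxy
  apply h.isResolvent_self.injective
  rw [← h.negSqrt_mul_self]
  exact congrArg (negSqrt A z) hxy

theorem exists_negSqrt_mul_eq_sub (hz : ResolventDecay A z C) (hw : ResolventDecay A w C') :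
    ∃ D : H →L[ℂ] H, negSqrt A w - negSqrt A z = negSqrt A z * (negSqrt A w * D) := by
  set R : ℝ → H →L[ℂ] H := fun t => res A (z - t)
  set S : ℝ → H →L[ℂ] H := fun t => res A (w - t)
  have hsub : ∀ t ∈ Set.Ioi (0 : ℝ), (w - z) • (((√t : ℝ) : ℂ) • (S t * R t)) =
      ((√t : ℝ) : ℂ) • (S t - R t) := by
    intro t ht
    have h1 := (hw.isResolvent (le_of_lt ht)).sub_eq (hz.isResolvent (le_of_lt ht))
    rw [sub_sub_sub_cancel_right] at h1
    rw [h1, smul_comm]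
  have hint : IntegrableOn (fun t : ℝ => ((√t : ℝ) : ℂ) • (S t - R t)) (Set.Ioi 0) :=
    IntegrableOn.congr_fun ((hw.integrableOn_sqrt_smul_mul hz).smul (w - z)) hsub
      measurableSet_Ioi
  refine ⟨(Real.pi : ℂ)⁻¹ • ∫ t in Set.Ioi (0 : ℝ), ((√t : ℝ) : ℂ) • (S t - R t), ?_⟩
  set D := (Real.pi : ℂ)⁻¹ • ∫ t in Set.Ioi (0 : ℝ), ((√t : ℝ) : ℂ) • (S t - R t) with hD
  have hpt : ∀ t ∈ Set.Ioi (0 : ℝ), res A w * res A z * (((√t : ℝ) : ℂ) • (S t - R t)) =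
      res A w * (((√t : ℝ) : ℂ)⁻¹ • R t) - res A z * (((√t : ℝ) : ℂ)⁻¹ • S t) := by
    intro t ht
    have ht' : (0 : ℝ) < t := ht
    have hs : ((√t : ℝ) : ℂ) ≠ 0 := Complex.ofReal_ne_zero.2 (Real.sqrt_pos.2 ht').ne'
    have hts : (t : ℂ) = ((√t : ℝ) : ℂ) * ((√t : ℝ) : ℂ) := by
      rw [← Complex.ofReal_mul, Real.mul_self_sqrt ht'.le]
    have h1 : res A z - R t = (t : ℂ) • (res A z * R t) := by
      simpa only [sub_sub_cancel] using hz.isResolvent_self.sub_eq (hz.isResolvent ht'.le)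
    have h2 : res A w - S t = (t : ℂ) • (res A w * S t) := by
      simpa only [sub_sub_cancel] using hw.isResolvent_self.sub_eq (hw.isResolvent ht'.le)
    have hc : res A w * res A z = res A z * res A w :=
      hw.isResolvent_self.commute hz.isResolvent_self
    have h3 : (t : ℂ) • (res A w * res A z * (S t - R t)) = res A w * R t - res A z * S t := by
      have h4 : (t : ℂ) • (res A w * res A z * S t) = res A z * (res A w - S t) := by
        rw [hc, mul_assoc, ← mul_smul_comm, ← h2]
      have h5 : (t : ℂ) • (res A w * res A z * R t) = res A w * (res A z - R t) := by
        rw [mul_assoc, ← mul_smul_comm, ← h1]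
      rw [mul_sub, smul_sub, h4, h5, mul_sub, mul_sub, hc]
      abel
    rw [mul_smul_comm, mul_smul_comm, mul_smul_comm, ← smul_sub, ← h3, smul_smul, hts,
      inv_mul_cancel_left₀ hs]
  have hi1 : IntegrableOn (fun t : ℝ => res A w * (((√t : ℝ) : ℂ)⁻¹ • R t)) (Set.Ioi 0) :=
    hz.integrableOn_negSqrt.const_mul (res A w)
  have hi2 : IntegrableOn (fun t : ℝ => res A z * (((√t : ℝ) : ℂ)⁻¹ • S t)) (Set.Ioi 0) :=
    hw.integrableOn_negSqrt.const_mul (res A z)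
  have hmain : res A w * res A z * D = res A w * negSqrt A z - res A z * negSqrt A w := by
    rw [hD, mul_smul_comm, ← integral_const_mul_of_integrable hint,
      setIntegral_congr_fun measurableSet_Ioi hpt, integral_sub hi1 hi2,
      integral_const_mul_of_integrable hz.integrableOn_negSqrt,
      integral_const_mul_of_integrable hw.integrableOn_negSqrt, smul_sub, negSqrt, negSqrt,
      mul_smul_comm, mul_smul_comm]
  have hc : negSqrt A w * negSqrt A z = negSqrt A z * negSqrt A w :=
    hz.commute_negSqrt_negSqrt hw
  have hprod : negSqrt A z * (negSqrt A w * (negSqrt A z * (negSqrt A w * D))) =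
      negSqrt A z * (negSqrt A w * (negSqrt A w - negSqrt A z)) := by
    have h1 : res A w * res A z * D =
        negSqrt A z * (negSqrt A w * (negSqrt A z * (negSqrt A w * D))) := by
      rw [← hz.negSqrt_mul_self, ← hw.negSqrt_mul_self]
      generalize negSqrt A w = N at hc ⊢
      generalize negSqrt A z = M at hc ⊢
      have hc' : ∀ X, N * (M * X) = M * (N * X) := fun X => by rw [← mul_assoc, hc, mul_assoc]
      simp only [mul_assoc, hc']
    rw [← h1, hmain, ← hz.negSqrt_mul_self, ← hw.negSqrt_mul_self]
    generalize negSqrt A w = N at hc ⊢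
    generalize negSqrt A z = M at hc ⊢
    have hc' : ∀ X, N * (M * X) = M * (N * X) := fun X => by rw [← mul_assoc, hc, mul_assoc]
    simp only [mul_assoc, mul_sub, hc', hc]
  ext x
  exact (hw.injective_negSqrt (hz.injective_negSqrt (DFunLike.congr_fun hprod x))).symm

theorem range_negSqrt_subset (hz : ResolventDecay A z C) (hw : ResolventDecay A w C') :
    Set.range (negSqrt A w) ⊆ Set.range (negSqrt A z) := by
  obtain ⟨D, hD⟩ := hz.exists_negSqrt_mul_eq_sub hw
  rintro _ ⟨x, rfl⟩
  refine ⟨x + negSqrt A w (D x), ?_⟩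
  have h1 : negSqrt A w x - negSqrt A z x = negSqrt A z (negSqrt A w (D x)) :=
    DFunLike.congr_fun hD x
  rw [map_add, ← h1]
  abel

theorem range_negSqrt_eq (hz : ResolventDecay A z C) (hw : ResolventDecay A w C') :
    Set.range (negSqrt A z) = Set.range (negSqrt A w) :=
  (hw.range_negSqrt_subset hz).antisymm (hz.range_negSqrt_subset hw)

end ResolventDecay

/-- Lemma 7.5: the inverse square roots `(A + t·I)^{-1/2}`, `t > t₀`,
extend analytically to `(A - z·I)^{-1/2}` (given by the integral formula defining `negSqrt`)
on `ℂ \ closure(-t₀ + S_{ω₀})`, likewise for `A*`; moreover the square root domains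
`dom((A - z)^{1/2}) = ran((A - z)^{-1/2})` are independent of `z` there. -/
theorem statement3
    (A : H →ₗ.[ℂ] H) (t0 ω0 : ℝ)
    (hdense : Dense (A.domain : Set H)) (hclosed : IsClosed (A.graph : Set (H × H)))
    (hω0 : 0 ≤ ω0) (hω0' : ω0 < Real.pi)
    (hpos : IsPositiveTypeP (shiftP A (t0 : ℂ)))
    (hsect : IsSectorialP (shiftP A (t0 : ℂ)) ω0) :
    DifferentiableOn ℂ (fun z => negSqrt A z) (offSector t0 ω0) ∧
    DifferentiableOn ℂ (fun z => negSqrt A.adjoint z) (offSector t0 ω0) ∧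
    ∀ z ∈ offSector t0 ω0,
      Set.range (negSqrt A z) = Set.range (negSqrt A (-(t0 : ℂ))) ∧
      Set.range (negSqrt A.adjoint z) = Set.range (negSqrt A.adjoint (-(t0 : ℂ))) := by
  have hA : ∀ z ∈ offSector t0 ω0, ∃ C, ResolventDecay A z C := fun z hz =>
    hsect.exists_resolventDecay hω0 hω0' hz
  have hA' : ∀ z ∈ offSector t0 ω0, ∃ C, ResolventDecay A.adjoint z C := by
    intro z hz
    obtain ⟨C, hC⟩ := hA _ (conj_mem_offSector hz)
    exact ⟨C, by simpa using hC.adjoint hdense⟩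
  obtain ⟨C₀, h₀⟩ := hpos.exists_resolventDecay
  have h₀' : ResolventDecay A.adjoint (-(t0 : ℂ)) C₀ := by simpa using h₀.adjoint hdense
  refine ⟨fun z hz => ?_, fun z hz => ?_, fun z hz => ?_⟩
  · obtain ⟨C, hC⟩ := hA z hz
    exact hC.hasDerivAt_negSqrt.differentiableAt.differentiableWithinAt
  · obtain ⟨C, hC⟩ := hA' z hz
    exact hC.hasDerivAt_negSqrt.differentiableAt.differentiableWithinAt
  · obtain ⟨C, hC⟩ := hA z hz
    obtain ⟨C', hC'⟩ := hA' z hz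
    exact ⟨hC.range_negSqrt_eq h₀, hC'.range_negSqrt_eq h₀'⟩

end
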